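/- There exist smooth 2π-periodic functions v, ψ : ℝ → ℝ such that for every integer k ≥ 0 there is a constant C_k > 0 with |∂_θ^k ( P(θ,τ) − v(θ)·τ − ψ(θ) )| ≤ C_k (1 + τ) e^{−2τ} for all θ ∈ ℝ and all τ ≥ 0; i.e., P(·,τ) − vτ − ψ converges to zero exponentially in every C^k norm as τ → ∞. -/

import Mathlib

open Real

open Filter Topology Set

/-- The partial derivative in the first variable. -/
noncomputable def partialFst (u : ℝ × ℝ → ℝ) : ℝ × ℝ → ℝ := fun p => fderiv ℝ u p (1, 0)

/-- The partial derivative in the second variable. -/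
noncomputable def partialSnd (u : ℝ × ℝ → ℝ) : ℝ × ℝ → ℝ := fun p => fderiv ℝ u p (0, 1)

section PartialDerivatives

variable {u : ℝ × ℝ → ℝ}

theorem ContDiff.partialFst (hu : ContDiff ℝ (⊤ : ℕ∞) u) :
    ContDiff ℝ (⊤ : ℕ∞) (partialFst u) :=
  (hu.fderiv_right (m := (⊤ : ℕ∞)) (by simp)).clm_apply contDiff_const

theorem ContDiff.partialSnd (hu : ContDiff ℝ (⊤ : ℕ∞) u) :
    ContDiff ℝ (⊤ : ℕ∞) (partialSnd u) :=
  (hu.fderiv_right (m := (⊤ : ℕ∞)) (by simp)).clm_apply contDiff_const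

theorem ContDiff.hasDerivAt_partialFst (hu : ContDiff ℝ (⊤ : ℕ∞) u) (x t : ℝ) :
    HasDerivAt (fun s => u (s, t)) (_root_.partialFst u (x, t)) x := by
  have h := (hu.differentiable (by simp) (x, t)).hasFDerivAt
  exact h.comp_hasDerivAt x ((hasDerivAt_id x).prodMk (hasDerivAt_const x t))

theorem ContDiff.hasDerivAt_partialSnd (hu : ContDiff ℝ (⊤ : ℕ∞) u) (x t : ℝ) :
    HasDerivAt (fun s => u (x, s)) (_root_.partialSnd u (x, t)) t := by
  have h := (hu.differentiable (by simp) (x, t)).hasFDerivAt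
  exact h.comp_hasDerivAt t ((hasDerivAt_const t x).prodMk (hasDerivAt_id t))

theorem partialFst_partialSnd (hu : ContDiff ℝ (⊤ : ℕ∞) u) :
    partialFst (partialSnd u) = partialSnd (partialFst u) := by
  funext p
  have hd : DifferentiableAt ℝ (fderiv ℝ u) p :=
    (hu.fderiv_right (m := (⊤ : ℕ∞)) (by simp)).differentiable (by simp) p
  have hs : IsSymmSndFDerivAt ℝ u p :=
    hu.contDiffAt.isSymmSndFDerivAt (by
      rw [minSmoothness_of_isRCLikeNormedField]
      exact WithTop.coe_le_coe.2 (le_top : (2 : ℕ∞) ≤ ⊤))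
  have key : ∀ v w : ℝ × ℝ, fderiv ℝ (fun q => fderiv ℝ u q v) p w
      = fderiv ℝ (fderiv ℝ u) p w v := fun v w => by
    rw [fderiv_clm_apply hd (differentiableAt_const v)]
    simp
  exact (key (0, 1) (1, 0)).trans ((hs (1, 0) (0, 1)).trans (key (1, 0) (0, 1)).symm)

theorem partialFst_periodic {c : ℝ} (hu : ContDiff ℝ (⊤ : ℕ∞) u)
    (hper : ∀ x t, u (x + c, t) = u (x, t)) (x t : ℝ) :
    partialFst u (x + c, t) = partialFst u (x, t) := by
  have h := (hu.hasDerivAt_partialFst (x + c) t).comp_add_const x c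
  simp only [hper] at h
  exact h.unique (hu.hasDerivAt_partialFst x t)

theorem partialSnd_periodic {c : ℝ} (hu : ContDiff ℝ (⊤ : ℕ∞) u)
    (hper : ∀ x t, u (x + c, t) = u (x, t)) (x t : ℝ) :
    partialSnd u (x + c, t) = partialSnd u (x, t) := by
  have h := hu.hasDerivAt_partialSnd (x + c) t
  simp only [hper] at h
  exact h.unique (hu.hasDerivAt_partialSnd x t)

theorem iteratedDeriv_fst_eq (hu : ContDiff ℝ (⊤ : ℕ∞) u) (k : ℕ) (t : ℝ) :
    iteratedDeriv k (fun s => u (s, t)) = fun s => (partialFst^[k] u) (s, t) := by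
  induction k generalizing u with
  | zero => simp
  | succ k ih =>
    rw [iteratedDeriv_succ', Function.iterate_succ_apply, ← ih hu.partialFst]
    congr 1
    funext x
    exact (hu.hasDerivAt_partialFst x t).deriv

theorem iteratedDeriv_snd_eq (hu : ContDiff ℝ (⊤ : ℕ∞) u) (k : ℕ) (x : ℝ) :
    iteratedDeriv k (fun t => u (x, t)) = fun t => (partialSnd^[k] u) (x, t) := by
  induction k generalizing u with
  | zero => simp
  | succ k ih =>
    rw [iteratedDeriv_succ', Function.iterate_succ_apply, ← ih hu.partialSnd]
    congr 1
    funext t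
    exact (hu.hasDerivAt_partialSnd x t).deriv

end PartialDerivatives

theorem exists_bound_of_continuous_periodic {f : ℝ → ℝ} {c : ℝ} (hc : 0 < c) (hf : Continuous f)
    (hper : Function.Periodic f c) : ∃ K, 0 ≤ K ∧ ∀ x, |f x| ≤ K := by
  obtain ⟨K, hK⟩ := isCompact_Icc.exists_bound_of_continuousOn (s := Icc 0 c) hf.continuousOn
  refine ⟨K, (norm_nonneg _).trans (hK 0 ⟨le_rfl, hc.le⟩), fun x => ?_⟩
  obtain ⟨y, hy, hxy⟩ := hper.exists_mem_Ico₀ hc x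
  rw [hxy]
  exact hK y (Ico_subset_Icc_self hy)

/-- A function on `[0, ∞)` whose derivative decays like `(1 + t) exp (-2 t)` converges at the
same rate. -/
theorem exists_limit_of_abs_deriv_le {h h' : ℝ → ℝ} {M : ℝ} (hM : 0 ≤ M)
    (hh : ∀ t, HasDerivAt h (h' t) t)
    (hb : ∀ t, 0 ≤ t → |h' t| ≤ M * (1 + t) * exp (-2 * t)) :
    ∃ b, ∀ t, 0 ≤ t → |h t - b| ≤ M * (1 + t) * exp (-2 * t) := by
  let φ : ℝ → ℝ := fun t => M * (3 / 4 + t / 2) * exp (-2 * t)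
  have hφ : ∀ t, HasDerivAt φ (-(M * (1 + t) * exp (-2 * t))) t := fun t => by
    have h1 : HasDerivAt (fun t : ℝ => M * (3 / 4 + t / 2)) (M * (1 / 2)) t :=
      (((hasDerivAt_id t).div_const 2).const_add (3 / 4)).const_mul M
    have h2 : HasDerivAt (fun t : ℝ => exp (-2 * t)) (exp (-2 * t) * (-2 * 1)) t :=
      ((hasDerivAt_id t).const_mul (-2)).exp
    refine (h1.mul h2).congr_deriv ?_
    ring
  have hmono : MonotoneOn (fun t => h t - φ t) (Ici 0) := by
    refine monotoneOn_of_hasDerivWithinAt_nonneg (convex_Ici 0)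
      (fun t _ => ((hh t).sub (hφ t)).continuousAt.continuousWithinAt)
      (fun t _ => ((hh t).sub (hφ t)).hasDerivWithinAt) fun t ht => ?_
    have ht : 0 ≤ t := interior_subset ht
    linarith [(abs_le.1 (hb t ht)).1]
  have hanti : AntitoneOn (fun t => h t + φ t) (Ici 0) := by
    refine antitoneOn_of_hasDerivWithinAt_nonpos (convex_Ici 0)
      (fun t _ => ((hh t).add (hφ t)).continuousAt.continuousWithinAt)
      (fun t _ => ((hh t).add (hφ t)).hasDerivWithinAt) fun t ht => ?_
    have ht : 0 ≤ t := interior_subset ht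
    linarith [(abs_le.1 (hb t ht)).2]
  have hφ0 : ∀ t, 0 ≤ t → 0 ≤ φ t := fun t ht => by positivity
  have hφle : ∀ t, 0 ≤ t → φ t ≤ M * (1 + t) * exp (-2 * t) := fun t ht => by
    have : 3 / 4 + t / 2 ≤ 1 + t := by linarith
    simp only [φ]
    gcongr
  have hcross : ∀ s, 0 ≤ s → ∀ t, 0 ≤ t → h s - φ s ≤ h t + φ t := fun s hs t ht => by
    have hm : (0 : ℝ) ≤ max s t := hs.trans (le_max_left s t)
    have h1 := hmono hs hm (le_max_left s t)
    have h2 := hanti ht hm (le_max_right s t)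
    have h3 := hφ0 _ hm
    simp only at h1 h2
    linarith
  have hne : ((fun t => h t - φ t) '' Ici 0).Nonempty := ⟨_, 0, self_mem_Ici, rfl⟩
  refine ⟨sSup ((fun t => h t - φ t) '' Ici 0), fun t ht => ?_⟩
  have h1 : h t - φ t ≤ sSup ((fun t => h t - φ t) '' Ici 0) :=
    le_csSup ⟨h t + φ t, by rintro _ ⟨s, hs, rfl⟩; exact hcross s hs t ht⟩ ⟨t, ht, rfl⟩
  have h2 : sSup ((fun t => h t - φ t) '' Ici 0) ≤ h t + φ t :=
    csSup_le hne (by rintro _ ⟨s, hs, rfl⟩; exact hcross s hs t ht)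
  have h3 := hφle t ht
  rw [abs_le]
  constructor <;> linarith

/-- The time derivative is nonnegative at a maximum over the past. -/
theorem HasDerivAt.nonneg_of_forall_past_le {g : ℝ → ℝ} {g' a t : ℝ} (hat : a < t)
    (hg : HasDerivAt g g' t) (hmax : ∀ s, a ≤ s → s ≤ t → g s ≤ g t) : 0 ≤ g' := by
  have h := (hasDerivAt_iff_tendsto_slope.1 hg).mono_left
    (nhdsWithin_mono t (fun s (hs : s ∈ Iio t) => ne_of_lt hs))
  refine ge_of_tendsto h ?_
  filter_upwards [Ioo_mem_nhdsLT hat] with s hs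
  rw [slope_def_field]
  exact div_nonneg_of_nonpos (by linarith [hmax s hs.1.le hs.2.le]) (by linarith [hs.2])

/-- The maximum principle for a symmetric, weakly coupled pair of transport equations. -/
theorem transport_pair_le {A B A₁ A₂ B₁ B₂ : ℝ × ℝ → ℝ} {c K : ℝ} (hc : 0 < c)
    (hAc : Continuous A) (hBc : Continuous B)
    (hAp : ∀ x t, A (x + c, t) = A (x, t)) (hBp : ∀ x t, B (x + c, t) = B (x, t))
    (hA₁ : ∀ x t, HasDerivAt (fun s => A (s, t)) (A₁ (x, t)) x)
    (hA₂ : ∀ x t, HasDerivAt (fun s => A (x, s)) (A₂ (x, t)) t)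
    (hB₁ : ∀ x t, HasDerivAt (fun s => B (s, t)) (B₁ (x, t)) x)
    (hB₂ : ∀ x t, HasDerivAt (fun s => B (x, s)) (B₂ (x, t)) t)
    (hA : ∀ x t, 0 ≤ t → A₂ (x, t) = exp (-t) * A₁ (x, t) - (A (x, t) - B (x, t)) / 2)
    (hB : ∀ x t, 0 ≤ t → B₂ (x, t) = -exp (-t) * B₁ (x, t) + (A (x, t) - B (x, t)) / 2)
    (hA0 : ∀ x, A (x, 0) ≤ K) (hB0 : ∀ x, B (x, 0) ≤ K) (x t : ℝ) (ht : 0 ≤ t) :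
    A (x, t) ≤ K ∧ B (x, t) ≤ K := by
  have main : ∀ ε > 0, max (A (x, t)) (B (x, t)) ≤ K + ε * t := by
    intro ε hε
    let Z : ℝ × ℝ → ℝ := fun p => max (A p) (B p) - ε * p.2
    obtain ⟨⟨x₀, t₀⟩, ⟨-, ht₀⟩, hmax⟩ := (isCompact_Icc.prod isCompact_Icc).exists_isMaxOn
      (s := Icc (0 : ℝ) c ×ˢ Icc (0 : ℝ) t) ⟨(0, 0), ⟨⟨le_rfl, hc.le⟩, ⟨le_rfl, ht⟩⟩⟩
      (f := Z) (by fun_prop)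
    have hZ : ∀ y s, 0 ≤ s → s ≤ t → Z (y, s) ≤ Z (x₀, t₀) := by
      intro y s hs hst
      have hp : Function.Periodic (fun y => Z (y, s)) c := fun y => by simp [Z, hAp, hBp]
      obtain ⟨z, hz, hyz⟩ := hp.exists_mem_Ico₀ hc y
      rw [hyz]
      exact hmax ⟨Ico_subset_Icc_self hz, hs, hst⟩
    have hstrict : ∀ {F F₁ F₂ : ℝ × ℝ → ℝ},
        (∀ x t, HasDerivAt (fun s => F (s, t)) (F₁ (x, t)) x) →
        (∀ x t, HasDerivAt (fun s => F (x, s)) (F₂ (x, t)) t) →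
        (∀ p, F p ≤ max (A p) (B p)) → F (x₀, t₀) = max (A (x₀, t₀)) (B (x₀, t₀)) →
        0 < t₀ → F₁ (x₀, t₀) = 0 ∧ ε ≤ F₂ (x₀, t₀) := by
      intro F F₁ F₂ hF₁ hF₂ hle heq hpos
      constructor
      · refine IsLocalMax.hasDerivAt_eq_zero (f := fun s => F (s, t₀)) (a := x₀) ?_ (hF₁ x₀ t₀)
        refine Eventually.of_forall fun y => ?_
        have h1 := hZ y t₀ ht₀.1 ht₀.2
        have h2 := hle (y, t₀)
        simp only [Z] at h1 h2 ⊢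
        linarith
      · have h := ((hF₂ x₀ t₀).sub ((hasDerivAt_id t₀).const_mul ε)).nonneg_of_forall_past_le hpos
          (fun s hs hst => by
            have h1 := hZ x₀ s hs (hst.trans ht₀.2)
            have h2 := hle (x₀, s)
            simp only [Z, id, Pi.sub_apply] at h1 h2 ⊢
            linarith)
        linarith
    have ht₀' : t₀ = 0 := by
      by_contra hne
      have hpos : 0 < t₀ := lt_of_le_of_ne ht₀.1 (Ne.symm hne)
      rcases le_total (B (x₀, t₀)) (A (x₀, t₀)) with hAB | hAB
      · obtain ⟨h1, h2⟩ := hstrict hA₁ hA₂ (fun p => le_max_left _ _)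
          (max_eq_left hAB).symm hpos
        rw [hA _ _ ht₀.1, h1] at h2
        linarith
      · obtain ⟨h1, h2⟩ := hstrict hB₁ hB₂ (fun p => le_max_right _ _)
          (max_eq_right hAB).symm hpos
        rw [hB _ _ ht₀.1, h1] at h2
        linarith
    have h1 := hZ x t ht le_rfl
    have h2 : max (A (x₀, 0)) (B (x₀, 0)) ≤ K := max_le (hA0 _) (hB0 _)
    simp only [Z, ht₀'] at h1
    linarith
  rw [← max_le_iff]
  refine le_of_forall_pos_le_add fun ε hε => ?_
  have h1 := main (ε / (1 + t)) (by positivity)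
  have h2 : ε / (1 + t) * t ≤ ε := by
    rw [div_mul_eq_mul_div, div_le_iff₀ (by linarith)]
    nlinarith
  linarith

/-- Smooth solutions, periodic in space, of the polarised Gowdy equation for nonnegative times. -/
structure IsGowdySolution (c : ℝ) (u : ℝ × ℝ → ℝ) : Prop where
  contDiff : ContDiff ℝ (⊤ : ℕ∞) u
  periodic : ∀ x t, u (x + c, t) = u (x, t)
  wave : ∀ x t, 0 ≤ t →
    partialSnd (partialSnd u) (x, t) = exp (-2 * t) * partialFst (partialFst u) (x, t)

namespace IsGowdySolution

variable {c : ℝ} {u : ℝ × ℝ → ℝ}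

theorem partialFst (h : IsGowdySolution c u) : IsGowdySolution c (partialFst u) where
  contDiff := h.contDiff.partialFst
  periodic := partialFst_periodic h.contDiff h.periodic
  wave x t ht := by
    rw [← partialFst_partialSnd h.contDiff, ← partialFst_partialSnd h.contDiff.partialSnd]
    have h1 := h.contDiff.partialSnd.partialSnd.hasDerivAt_partialFst x t
    simp only [h.wave _ t ht] at h1
    exact h1.unique
      ((h.contDiff.partialFst.partialFst.hasDerivAt_partialFst x t).const_mul (exp (-2 * t)))

theorem iterate_partialFst (h : IsGowdySolution c u) (k : ℕ) :
    IsGowdySolution c (_root_.partialFst^[k] u) := by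
  induction k with
  | zero => exact h
  | succ k ih =>
    rw [Function.iterate_succ_apply']
    exact ih.partialFst

theorem neg (h : IsGowdySolution c u) : IsGowdySolution c (-u) := by
  have h1 : ∀ v : ℝ × ℝ → ℝ, _root_.partialFst (-v) = -_root_.partialFst v := fun v => by
    funext p; simp [_root_.partialFst, fderiv_neg]
  have h2 : ∀ v : ℝ × ℝ → ℝ, partialSnd (-v) = -partialSnd v := fun v => by
    funext p; simp [partialSnd, fderiv_neg]
  refine ⟨h.contDiff.neg, fun x t => by simp [h.periodic], fun x t ht => ?_⟩
  simp only [h1, h2, Pi.neg_apply, h.wave x t ht, mul_neg]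

theorem exists_partialSnd_le (hc : 0 < c) (h : IsGowdySolution c u) :
    ∃ K, ∀ x t, 0 ≤ t → partialSnd u (x, t) ≤ K := by
  have hu := h.contDiff
  have hcomm := partialFst_partialSnd hu
  have hexp : ∀ t : ℝ, HasDerivAt (fun s : ℝ => exp (-s)) (-exp (-t)) t := fun t => by
    simpa using (hasDerivAt_id t).neg.exp
  have hexp2 : ∀ t : ℝ, exp (-2 * t) = exp (-t) * exp (-t) := fun t => by
    rw [← exp_add]; ring_nf
  have hc1 := hu.partialFst.continuous
  have hc2 := hu.partialSnd.continuous
  have hp1 := partialFst_periodic hu h.periodic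
  have hp2 := partialSnd_periodic hu h.periodic
  let A : ℝ × ℝ → ℝ := fun p => partialSnd u p + exp (-p.2) * _root_.partialFst u p
  let B : ℝ × ℝ → ℝ := fun p => partialSnd u p - exp (-p.2) * _root_.partialFst u p
  have hAc : Continuous A := by fun_prop
  have hBc : Continuous B := by fun_prop
  have hAp : ∀ x t, A (x + c, t) = A (x, t) := fun x t => by simp [A, hp1, hp2]
  have hBp : ∀ x t, B (x + c, t) = B (x, t) := fun x t => by simp [B, hp1, hp2]
  obtain ⟨K₁, -, hK₁⟩ := exists_bound_of_continuous_periodic hc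
    (f := fun x => A (x, 0)) (by fun_prop) (fun x => hAp x 0)
  obtain ⟨K₂, -, hK₂⟩ := exists_bound_of_continuous_periodic hc
    (f := fun x => B (x, 0)) (by fun_prop) (fun x => hBp x 0)
  refine ⟨max K₁ K₂, fun x t ht => ?_⟩
  have hfst : ∀ x t, HasDerivAt (fun s => exp (-t) * _root_.partialFst u (s, t))
      (exp (-t) * _root_.partialFst (_root_.partialFst u) (x, t)) x := fun x t =>
    (hu.partialFst.hasDerivAt_partialFst x t).const_mul _
  have hsnd : ∀ x t, HasDerivAt (fun s => exp (-s) * _root_.partialFst u (x, s))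
      (-exp (-t) * _root_.partialFst u (x, t)
        + exp (-t) * partialSnd (_root_.partialFst u) (x, t)) t := fun x t =>
    (hexp t).mul (hu.partialFst.hasDerivAt_partialSnd x t)
  have hmax := transport_pair_le (K := max K₁ K₂) hc hAc hBc hAp hBp
    (A₁ := fun p => _root_.partialFst (partialSnd u) p
      + exp (-p.2) * _root_.partialFst (_root_.partialFst u) p)
    (A₂ := fun p => partialSnd (partialSnd u) p + (-exp (-p.2) * _root_.partialFst u p
      + exp (-p.2) * partialSnd (_root_.partialFst u) p))
    (B₁ := fun p => _root_.partialFst (partialSnd u) p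
      - exp (-p.2) * _root_.partialFst (_root_.partialFst u) p)
    (B₂ := fun p => partialSnd (partialSnd u) p - (-exp (-p.2) * _root_.partialFst u p
      + exp (-p.2) * partialSnd (_root_.partialFst u) p))
    (fun x t => (hu.partialSnd.hasDerivAt_partialFst x t).add (hfst x t))
    (fun x t => (hu.partialSnd.hasDerivAt_partialSnd x t).add (hsnd x t))
    (fun x t => (hu.partialSnd.hasDerivAt_partialFst x t).sub (hfst x t))
    (fun x t => (hu.partialSnd.hasDerivAt_partialSnd x t).sub (hsnd x t))
    (fun x t ht => by simp only [A, B, h.wave x t ht, hexp2, hcomm]; ring)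
    (fun x t ht => by simp only [A, B, h.wave x t ht, hexp2, hcomm]; ring)
    (fun x => ((le_abs_self _).trans (hK₁ x)).trans (le_max_left _ _))
    (fun x => ((le_abs_self _).trans (hK₂ x)).trans (le_max_right _ _)) x t ht
  simp only [A, B] at hmax
  linarith [hmax.1, hmax.2]

theorem exists_abs_partialSnd_le (hc : 0 < c) (h : IsGowdySolution c u) :
    ∃ K, 0 ≤ K ∧ ∀ x t, 0 ≤ t → |partialSnd u (x, t)| ≤ K := by
  obtain ⟨K₁, hK₁⟩ := h.exists_partialSnd_le hc
  obtain ⟨K₂, hK₂⟩ := h.neg.exists_partialSnd_le hc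
  have hneg : ∀ p, partialSnd (-u) p = -partialSnd u p := fun p => by
    simp [partialSnd, fderiv_neg]
  have key : ∀ x t, 0 ≤ t → |partialSnd u (x, t)| ≤ max K₁ K₂ := fun x t ht =>
    abs_le'.2 ⟨(hK₁ x t ht).trans (le_max_left _ _),
      (hneg (x, t) ▸ hK₂ x t ht).trans (le_max_right _ _)⟩
  exact ⟨_, (abs_nonneg _).trans (key 0 0 le_rfl), key⟩

theorem exists_abs_le (hc : 0 < c) (h : IsGowdySolution c u) :
    ∃ N, 0 ≤ N ∧ ∀ x t, 0 ≤ t → |u (x, t)| ≤ N * (1 + t) := by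
  obtain ⟨K, hK0, hK⟩ := h.exists_abs_partialSnd_le hc
  have hcont := h.contDiff.continuous
  obtain ⟨L, hL0, hL⟩ := exists_bound_of_continuous_periodic hc (f := fun x => u (x, 0))
    (by fun_prop) (fun x => h.periodic x 0)
  refine ⟨K + L, by positivity, fun x t ht => ?_⟩
  have h1 := norm_image_sub_le_of_norm_deriv_le_segment' (a := 0) (b := t) (C := K)
    (fun s _ => (h.contDiff.hasDerivAt_partialSnd x s).hasDerivWithinAt)
    (fun s hs => hK x s hs.1) t ⟨ht, le_rfl⟩
  have h2 := abs_le.1 (hL x)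
  have h3 := abs_le.1 h1
  have h4 : 0 ≤ L * t := by positivity
  rw [abs_le]
  constructor <;> nlinarith

theorem exists_asymptotics (hc : 0 < c) (h : IsGowdySolution c u) :
    ∃ C, 0 ≤ C ∧ ∃ a b : ℝ → ℝ, ∀ x t, 0 ≤ t →
      |partialSnd u (x, t) - a x| ≤ C * (1 + t) * exp (-2 * t) ∧
      |u (x, t) - a x * t - b x| ≤ C * (1 + t) * exp (-2 * t) := by
  obtain ⟨C, hC0, hC⟩ := h.partialFst.partialFst.exists_abs_le hc
  have ha : ∀ x, ∃ a, ∀ t, 0 ≤ t → |partialSnd u (x, t) - a| ≤ C * (1 + t) * exp (-2 * t) :=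
    fun x => exists_limit_of_abs_deriv_le hC0
      (fun t => h.contDiff.partialSnd.hasDerivAt_partialSnd x t) fun t ht => by
        rw [h.wave x t ht, abs_mul, abs_of_pos (exp_pos _), mul_comm]
        gcongr
        exact hC x t ht
  choose a ha using ha
  have hb : ∀ x, ∃ b, ∀ t, 0 ≤ t → |u (x, t) - a x * t - b| ≤ C * (1 + t) * exp (-2 * t) :=
    fun x => exists_limit_of_abs_deriv_le hC0 (fun t =>
      ((h.contDiff.hasDerivAt_partialSnd x t).sub
        ((hasDerivAt_id t).const_mul (a x))).congr_deriv (by rw [mul_one])) (ha x)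
  choose b hb using hb
  exact ⟨C, hC0, a, b, fun x t ht => ⟨ha x t ht, hb x t ht⟩⟩

end IsGowdySolution

theorem tendsto_natCast_mul_exp_neg (C : ℝ) :
    Tendsto (fun n : ℕ => C * (1 + (n : ℝ)) * exp (-2 * n)) atTop (𝓝 0) := by
  have h1 : Tendsto (fun t : ℝ => (2 * t) ^ 1 * exp (-(2 * t))) atTop (𝓝 0) :=
    (tendsto_pow_mul_exp_neg_atTop_nhds_zero 1).comp (tendsto_id.const_mul_atTop two_pos)
  have h0 : Tendsto (fun t : ℝ => (2 * t) ^ 0 * exp (-(2 * t))) atTop (𝓝 0) :=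
    (tendsto_pow_mul_exp_neg_atTop_nhds_zero 0).comp (tendsto_id.const_mul_atTop two_pos)
  have h := (((h0.add (h1.const_mul (1 / 2))).const_mul C).comp tendsto_natCast_atTop_atTop)
  simp only [mul_zero, add_zero] at h
  refine h.congr fun n => ?_
  simp only [Function.comp, pow_zero, pow_one, neg_mul]
  ring

theorem tendstoUniformly_of_abs_sub_le {α : Type*} {f : ℕ → α → ℝ} {g : α → ℝ} {e : ℕ → ℝ}
    (he : Tendsto e atTop (𝓝 0)) (h : ∀ n x, |f n x - g x| ≤ e n) :
    TendstoUniformly f g atTop := by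
  rw [Metric.tendstoUniformly_iff]
  intro ε hε
  filter_upwards [he.eventually_lt_const hε] with n hn x
  rw [dist_comm, Real.dist_eq]
  exact (h n x).trans_lt hn

theorem iteratedDeriv_of_hasDerivAt_succ {v : ℕ → ℝ → ℝ}
    (hv : ∀ k x, HasDerivAt (v k) (v (k + 1) x) x) (k : ℕ) : iteratedDeriv k (v 0) = v k := by
  induction k with
  | zero => simp
  | succ k ih =>
    rw [iteratedDeriv_succ, ih]
    exact funext fun x => (hv k x).deriv

theorem contDiff_of_hasDerivAt_succ {v : ℕ → ℝ → ℝ}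
    (hv : ∀ k x, HasDerivAt (v k) (v (k + 1) x) x) : ContDiff ℝ (⊤ : ℕ∞) (v 0) :=
  contDiff_of_differentiable_iteratedDeriv fun k _ => by
    rw [iteratedDeriv_of_hasDerivAt_succ hv k]
    exact fun x => (hv k x).differentiableAt

/-- Polarised T³-Gowdy: if `P` is smooth, `2π`-periodic in `θ`, and satisfies
`∂_τ² P = e^{-2τ} ∂_θ² P` for `τ ≥ 0`, then there exist smooth `2π`-periodic
functions `v, ψ : ℝ → ℝ` such that for every `k ≥ 0` there is a constant `C_k > 0`
with `|∂_θ^k (P(θ,τ) - v(θ)·τ - ψ(θ))| ≤ C_k (1 + τ) e^{-2τ}` for all `θ ∈ ℝ` and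
all `τ ≥ 0`; i.e. `P(·,τ) - vτ - ψ → 0` exponentially in every `C^k` norm. -/
theorem gowdy_asymptotic_expansion (P : ℝ → ℝ → ℝ)
    (hP : ContDiff ℝ (⊤ : ℕ∞) (fun p : ℝ × ℝ => P p.1 p.2))
    (hper : ∀ θ τ : ℝ, P (θ + 2 * π) τ = P θ τ)
    (heq : ∀ θ τ : ℝ, 0 ≤ τ →
      iteratedDeriv 2 (fun t => P θ t) τ =
        Real.exp (-2 * τ) * iteratedDeriv 2 (fun s => P s τ) θ) :
    ∃ v ψ : ℝ → ℝ, ContDiff ℝ (⊤ : ℕ∞) v ∧ ContDiff ℝ (⊤ : ℕ∞) ψ ∧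
      (∀ θ : ℝ, v (θ + 2 * π) = v θ) ∧ (∀ θ : ℝ, ψ (θ + 2 * π) = ψ θ) ∧
      ∀ k : ℕ, ∃ C : ℝ, 0 < C ∧ ∀ θ τ : ℝ, 0 ≤ τ →
        |iteratedDeriv k (fun s => P s τ - v s * τ - ψ s) θ| ≤
          C * (1 + τ) * Real.exp (-2 * τ) := by
  have hu : IsGowdySolution (2 * π) (fun p : ℝ × ℝ => P p.1 p.2) := by
    refine ⟨hP, hper, fun x t ht => ?_⟩
    have h1 := congrFun (iteratedDeriv_snd_eq hP 2 x) t
    have h2 := congrFun (iteratedDeriv_fst_eq hP 2 t) x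
    have h3 := heq x t ht
    simp only at h1 h2
    rw [h1, h2] at h3
    exact h3
  set u : ℝ × ℝ → ℝ := fun p => P p.1 p.2
  have hk := fun k => hu.iterate_partialFst k
  choose C hC0 v ψ hvψ using fun k => (hk k).exists_asymptotics two_pi_pos
  have hvu : ∀ k, TendstoUniformly
      (fun (n : ℕ) x => partialSnd (partialFst^[k] u) (x, n)) (v k) atTop := fun k =>
    tendstoUniformly_of_abs_sub_le (tendsto_natCast_mul_exp_neg (C k))
      fun n x => (hvψ k x n n.cast_nonneg).1
  have hψu : ∀ k, TendstoUniformly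
      (fun (n : ℕ) x => (partialFst^[k] u) (x, n) - v k x * n) (ψ k) atTop := fun k =>
    tendstoUniformly_of_abs_sub_le (tendsto_natCast_mul_exp_neg (C k))
      fun n x => (hvψ k x n n.cast_nonneg).2
  have hfst : ∀ k x t, HasDerivAt (fun s => (partialFst^[k] u) (s, t))
      ((partialFst^[k + 1] u) (x, t)) x := fun k x t => by
    rw [Function.iterate_succ_apply']
    exact (hk k).contDiff.hasDerivAt_partialFst x t
  have hv : ∀ k x, HasDerivAt (v k) (v (k + 1) x) x := fun k =>
    hasDerivAt_of_tendstoUniformly (hvu (k + 1)) (Eventually.of_forall fun n x => by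
      rw [Function.iterate_succ_apply', ← partialFst_partialSnd (hk k).contDiff]
      exact (hk k).contDiff.partialSnd.hasDerivAt_partialFst x n) (fun x => (hvu k).tendsto_at x)
  have hψ : ∀ k x, HasDerivAt (ψ k) (ψ (k + 1) x) x := fun k =>
    hasDerivAt_of_tendstoUniformly (hψu (k + 1)) (Eventually.of_forall fun n x =>
      (hfst k x n).sub ((hv k x).mul_const (n : ℝ))) (fun x => (hψu k).tendsto_at x)
  have hvper : ∀ x, v 0 (x + 2 * π) = v 0 x := fun x => by
    refine tendsto_nhds_unique ((hvu 0).tendsto_at (x + 2 * π)) ?_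
    simp only [partialSnd_periodic (hk 0).contDiff (hk 0).periodic]
    exact (hvu 0).tendsto_at x
  have hψper : ∀ x, ψ 0 (x + 2 * π) = ψ 0 x := fun x => by
    refine tendsto_nhds_unique ((hψu 0).tendsto_at (x + 2 * π)) ?_
    simp only [(hk 0).periodic, hvper]
    exact (hψu 0).tendsto_at x
  refine ⟨v 0, ψ 0, contDiff_of_hasDerivAt_succ hv, contDiff_of_hasDerivAt_succ hψ,
    hvper, hψper, fun k => ⟨C k + 1, by linarith [hC0 k], fun θ τ hτ => ?_⟩⟩
  have hit := congrFun (iteratedDeriv_of_hasDerivAt_succ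
    (v := fun k s => (partialFst^[k] u) (s, τ) - v k s * τ - ψ k s)
    (fun k x => ((hfst k x τ).sub ((hv k x).mul_const τ)).sub (hψ k x)) k) θ
  have hit' : iteratedDeriv k (fun s => P s τ - v 0 s * τ - ψ 0 s) θ
      = (partialFst^[k] u) (θ, τ) - v k θ * τ - ψ k θ := hit
  rw [hit']
  refine (hvψ k θ τ hτ).2.trans ?_
  gcongr
  linarith
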